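/- arXiv:2009.09248 — 2 statements merged into one kernel-verified Lean document; each statement's English description precedes it below -/
import Mathlib

section
/- Exact expected optimism of the in-sample estimator in the normal–normal model: let μ_T ∈ ℝ, σ_T > 0, and let y = (y₁,…,yₙ) be distributed according to the n-fold product of the Gaussian measure N(μ_T, σ_T²). For each y define μ̂(y) = σ̂²(μ₀/τ₀² + Σ_{i=1}^n y_i/σ_A²), η(y) = −(1/2)log(2πσ_A²) − (σ_T² + (μ_T − μ̂(y))² + σ̂²)/(2σ_A²), and η̂(y) = −(1/2)log(2πσ_A²) − (1/n)Σ_{i=1}^n ((y_i − μ̂(y))² + σ̂²)/(2σ_A²). Then the expectation over y of η̂(y) − η(y) equals σ_T² σ̂² / σ_A⁴; in particular it is strictly positive, so η̂ overestimates η on average. -/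
open MeasureTheory ProbabilityTheory Real

theorem memLp_two_sub_mean_gaussianReal (m : ℝ) (v : NNReal) :
    MemLp (fun x : ℝ => x - m) 2 (gaussianReal m v) :=
  (memLp_id_gaussianReal' 2 (by simp)).sub (memLp_const m)

theorem integral_sub_mean_gaussianReal (m : ℝ) (v : NNReal) :
    ∫ x, (x - m) ∂(gaussianReal m v) = 0 := by
  have h : Integrable (fun x : ℝ => x) (gaussianReal m v) :=
    (memLp_id_gaussianReal' 2 (by simp)).integrable (by simp)
  rw [integral_sub h (integrable_const m)]
  simp

theorem integral_sub_mean_sq_gaussianReal (m : ℝ) (v : NNReal) :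
    ∫ x, (x - m) ^ 2 ∂(gaussianReal m v) = v := by
  rw [← variance_fun_id_gaussianReal (μ := m) (v := v),
    variance_eq_integral (by fun_prop), integral_id_gaussianReal]

theorem memLp_two_sub_mean_pi_gaussianReal {n : ℕ} (m : ℝ) (v : NNReal) (i : Fin n) :
    MemLp (fun y : Fin n → ℝ => y i - m) 2 (Measure.pi fun _ => gaussianReal m v) :=
  (memLp_two_sub_mean_gaussianReal m v).comp_measurePreserving
    (measurePreserving_eval (fun _ : Fin n => gaussianReal m v) i)

theorem integral_sub_mean_pi_gaussianReal {n : ℕ} (m : ℝ) (v : NNReal) (i : Fin n) :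
    ∫ y : Fin n → ℝ, (y i - m) ∂(Measure.pi fun _ => gaussianReal m v) = 0 := by
  rw [integral_comp_eval (μ := fun _ : Fin n => gaussianReal m v) (i := i)
    (f := fun x : ℝ => x - m) (by fun_prop), integral_sub_mean_gaussianReal]

theorem integral_sub_mean_sq_pi_gaussianReal {n : ℕ} (m : ℝ) (v : NNReal) (i : Fin n) :
    ∫ y : Fin n → ℝ, (y i - m) ^ 2 ∂(Measure.pi fun _ => gaussianReal m v) = v := by
  rw [integral_comp_eval (μ := fun _ : Fin n => gaussianReal m v) (i := i)
    (f := fun x : ℝ => (x - m) ^ 2) (by fun_prop), integral_sub_mean_sq_gaussianReal]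

theorem integral_sum_sub_mean_pi_gaussianReal (n : ℕ) (m : ℝ) (v : NNReal) :
    ∫ y : Fin n → ℝ, (∑ i, (y i - m)) ∂(Measure.pi fun _ => gaussianReal m v) = 0 := by
  rw [integral_finsetSum _ fun i _ =>
    (memLp_two_sub_mean_pi_gaussianReal m v i).integrable (by simp)]
  simp [integral_sub_mean_pi_gaussianReal]

theorem integral_sum_sub_mean_sq_pi_gaussianReal (n : ℕ) (m : ℝ) (v : NNReal) :
    ∫ y : Fin n → ℝ, (∑ i, (y i - m) ^ 2) ∂(Measure.pi fun _ => gaussianReal m v) = n * v := by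
  rw [integral_finsetSum _ fun i _ => (memLp_two_sub_mean_pi_gaussianReal m v i).integrable_sq]
  simp [integral_sub_mean_sq_pi_gaussianReal]

theorem integral_sq_sum_sub_mean_pi_gaussianReal (n : ℕ) (m : ℝ) (v : NNReal) :
    ∫ y : Fin n → ℝ, (∑ i, (y i - m)) ^ 2 ∂(Measure.pi fun _ => gaussianReal m v) = n * v := by
  have h := variance_sum_pi (μ := fun _ : Fin n => gaussianReal m v)
    (X := fun _ x => x - m) fun _ => memLp_two_sub_mean_gaussianReal m v
  have hv : Var[fun x => x - m; gaussianReal m v] = v := by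
    rw [variance_eq_integral (by fun_prop), integral_sub_mean_gaussianReal]
    simpa using integral_sub_mean_sq_gaussianReal m v
  have hf : (∑ i : Fin n, fun ω : Fin n → ℝ => ω i - m) = fun ω => ∑ i, (ω i - m) := by
    ext ω
    simp
  rw [hf, variance_of_integral_eq_zero (Measurable.aemeasurable (by fun_prop))
    (integral_sum_sub_mean_pi_gaussianReal n m v)] at h
  simpa [hv] using h

/-- The average squared deviation about `m + a + b S`, with `S` the sum of the centred data. -/
theorem sub_average_sq_deviation_eq {n : ℕ} (hn : 1 ≤ n) (y : Fin n → ℝ) (m a b : ℝ) :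
    (a + b * ∑ i, (y i - m)) ^ 2
        - 1 / (n : ℝ) * ∑ i, (y i - (m + (a + b * ∑ j, (y j - m)))) ^ 2
      = 2 * a / n * (∑ i, (y i - m)) + 2 * b / n * (∑ i, (y i - m)) ^ 2
        - 1 / n * ∑ i, (y i - m) ^ 2 := by
  have hn' : (n : ℝ) ≠ 0 := by positivity
  set S := ∑ i, (y i - m) with hS
  have h : ∑ i, (y i - (m + (a + b * S))) ^ 2
      = ∑ i, (y i - m) ^ 2 - 2 * (a + b * S) * S + n * (a + b * S) ^ 2 := by
    calc ∑ i, (y i - (m + (a + b * S))) ^ 2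
        = ∑ i, ((y i - m) ^ 2 - 2 * (a + b * S) * (y i - m) + (a + b * S) ^ 2) :=
          Finset.sum_congr rfl fun i _ => by ring
      _ = _ := by
          rw [Finset.sum_add_distrib, Finset.sum_sub_distrib, ← Finset.mul_sum, ← hS]
          simp
  rw [h]
  field_simp
  ring

/-- Exact expected optimism of the in-sample estimator in the normal–normal model:
with `y ∼ ⨂ᵢ N(μ_T, σ_T²)`, `E_y[η̂(y) − η(y)] = σ_T² σ̂² / σ_A⁴ > 0`. -/
theorem expected_optimism
    (σA τ0 μ0 : ℝ) (hσA : 0 < σA) (hτ0 : 0 < τ0)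
    (n : ℕ) (hn : 1 ≤ n)
    (σhat2 : ℝ) (hσhat2 : σhat2 = (1 / τ0 ^ 2 + n / σA ^ 2)⁻¹)
    (μT σT : ℝ) (hσT : 0 < σT)
    (P : Measure (Fin n → ℝ))
    (hP : P = Measure.pi fun _ : Fin n => gaussianReal μT (σT ^ 2).toNNReal)
    (μhat : (Fin n → ℝ) → ℝ)
    (hμhat : μhat = fun y => σhat2 * (μ0 / τ0 ^ 2 + ∑ i, y i / σA ^ 2))
    (η ηhat : (Fin n → ℝ) → ℝ)
    (hη : η = fun y => -(1 / 2) * Real.log (2 * Real.pi * σA ^ 2)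
      - (σT ^ 2 + (μT - μhat y) ^ 2 + σhat2) / (2 * σA ^ 2))
    (hηhat : ηhat = fun y => -(1 / 2) * Real.log (2 * Real.pi * σA ^ 2)
      - (1 / (n : ℝ)) * ∑ i, ((y i - μhat y) ^ 2 + σhat2) / (2 * σA ^ 2)) :
    (∫ y, (ηhat y - η y) ∂P = σT ^ 2 * σhat2 / σA ^ 4) ∧
      0 < σT ^ 2 * σhat2 / σA ^ 4 := by
  have hn' : (n : ℝ) ≠ 0 := by positivity
  have hσpos : 0 < σhat2 := by rw [hσhat2]; positivity
  refine ⟨?_, by positivity⟩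
  obtain ⟨a, b, hb, hμ⟩ : ∃ a b : ℝ, b = σhat2 / σA ^ 2 ∧
      ∀ y, μhat y = μT + (a + b * ∑ i, (y i - μT)) := by
    refine ⟨σhat2 * (μ0 / τ0 ^ 2 + n * μT / σA ^ 2) - μT, _, rfl, fun y => ?_⟩
    simp only [hμhat, Finset.sum_sub_distrib, ← Finset.sum_div, Finset.sum_const,
      Finset.card_univ, Fintype.card_fin, nsmul_eq_mul]
    ring
  have hdiff : ∀ y, ηhat y - η y = 1 / (2 * σA ^ 2) * (σT ^ 2
      + (2 * a / n * (∑ i, (y i - μT)) + 2 * b / n * (∑ i, (y i - μT)) ^ 2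
        - 1 / n * ∑ i, (y i - μT) ^ 2)) := by
    intro y
    rw [← sub_average_sq_deviation_eq hn, ← hμ y]
    have hy : a + b * ∑ i, (y i - μT) = μhat y - μT := by rw [hμ y]; ring
    simp only [hη, hηhat, hy, ← Finset.sum_div, Finset.sum_add_distrib, Finset.sum_const,
      Finset.card_univ, Fintype.card_fin, nsmul_eq_mul]
    field_simp
    ring
  simp_rw [hdiff]
  subst hP
  have hv : ((σT ^ 2).toNNReal : ℝ) = σT ^ 2 := Real.coe_toNNReal _ (by positivity)
  generalize (σT ^ 2).toNNReal = v at hv ⊢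
  have hL : MemLp (fun y : Fin n → ℝ => ∑ i, (y i - μT)) 2
      (Measure.pi fun _ => gaussianReal μT v) :=
    memLp_finsetSum _ fun i _ => memLp_two_sub_mean_pi_gaussianReal μT v i
  have h1 := (hL.integrable (by simp)).const_mul (2 * a / n)
  have h2 := hL.integrable_sq.const_mul (2 * b / n)
  have h3 := (integrable_finsetSum Finset.univ fun (i : Fin n) _ =>
    (memLp_two_sub_mean_pi_gaussianReal μT v i).integrable_sq).const_mul (1 / (n : ℝ))
  rw [integral_const_mul, integral_add (integrable_const _) (by fun_prop),
    integral_sub (h1.fun_add h2) h3, integral_add h1 h2, integral_const_mul, integral_const_mul,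
    integral_const_mul, integral_sum_sub_mean_pi_gaussianReal,
    integral_sum_sub_mean_sq_pi_gaussianReal, integral_sq_sum_sub_mean_pi_gaussianReal, hv, hb]
  simp only [integral_const, probReal_univ, smul_eq_mul]
  field_simp
  ring
end

section
/- Vanishing integral of the gradient of an integrable smooth function: let p ≥ 1 and let h : ℝᵖ → ℝ be continuously differentiable. If h is integrable with respect to Lebesgue measure on ℝᵖ and its gradient ∇h (equivalently, its Fréchet derivative) is integrable, then ∫_{ℝᵖ} ∇h(θ) dθ = 0; in particular, in dimension p = 1, if f : ℝ → ℝ is differentiable with both f and f′ Lebesgue integrable, then ∫_ℝ f′(θ) dθ = 0. -/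
open MeasureTheory

/-- The integral of a directional derivative of an integrable differentiable function vanishes,
provided this directional derivative is integrable. -/
theorem integral_fderiv_apply_eq_zero {E F : Type*} [NormedAddCommGroup E] [NormedSpace ℝ E]
    [FiniteDimensional ℝ E] [MeasurableSpace E] [BorelSpace E] {μ : Measure E}
    [μ.IsAddHaarMeasure] [NormedAddCommGroup F] [NormedSpace ℝ F] {f : E → F} {v : E}
    (hf : Differentiable ℝ f) (hInt : Integrable f μ)
    (hInt' : Integrable (fun x => fderiv ℝ f x v) μ) :
    ∫ x, fderiv ℝ f x v ∂μ = 0 := by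
  simpa using integral_smul_fderiv_eq_neg_fderiv_smul_of_integrable (μ := μ) (𝕜 := ℝ)
    (f := fun _ => 1) (g := f) (v := v) (by simp) (by simpa using hInt') (by simpa using hInt)
    (fun x _ => differentiableAt_const _) (fun x _ => hf x)

/-- Vanishing integral of the gradient of an integrable smooth function on `ℝᵖ`:
if `h` is `C¹`, Lebesgue-integrable and its gradient is Bochner integrable, then
`∫ ∇h = 0`; in particular, in dimension one, if `f : ℝ → ℝ` is differentiable with
`f` and `f'` integrable, then `∫ f' = 0`. -/
theorem integral_gradient_eq_zero
    (p : ℕ) (hp : 1 ≤ p) (h : EuclideanSpace ℝ (Fin p) → ℝ)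
    (hC1 : ContDiff ℝ 1 h)
    (hInt : Integrable h volume)
    (hIntGrad : Integrable (fun θ => gradient h θ) volume) :
    (∫ θ, gradient h θ = (0 : EuclideanSpace ℝ (Fin p))) ∧
      (∀ f : ℝ → ℝ, Differentiable ℝ f → Integrable f volume →
        Integrable (deriv f) volume → ∫ θ, deriv f θ = 0) := by
  refine ⟨ext_inner_right (𝕜 := ℝ) fun v => ?_, fun f hf hf_int hf'_int =>
    integral_eq_zero_of_hasDerivAt_of_integrable (fun x => (hf x).hasDerivAt) hf'_int hf_int⟩
  have inner_gradient (x : EuclideanSpace ℝ (Fin p)) :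
      inner ℝ v (gradient h x) = fderiv ℝ h x v := by
    simp [inner_gradient_right]
  have hInt' : Integrable (fun x => fderiv ℝ h x v) volume := by
    simpa only [inner_gradient] using hIntGrad.const_inner (𝕜 := ℝ) v
  rw [inner_zero_left, real_inner_comm, ← integral_inner hIntGrad]
  simp only [inner_gradient]
  exact integral_fderiv_apply_eq_zero (hC1.differentiable one_ne_zero) hInt hInt'
end
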